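/- arXiv:1508.02797 — 4 statements merged into one kernel-verified Lean document; each statement's English description precedes it below -/
import Mathlib

section
/- Let K ≥ 2 be an integer, let β > 0, and let λ_1,…,λ_K > 0 and P_1,…,P_K > 0 be real numbers. Let Ω ⊆ ℝ^K be the region Ω = { (r_1,…,r_K) : 0 < r_1 and r_{n+1} > (P_{n+1}/P_n)^{1/β} · r_n for all n = 1,…,K−1 }. Then the iterated integral over Ω of the function (r_1,…,r_K) ↦ (∏_{i=1}^K 2π λ_i r_i) · exp(−π Σ_{i=1}^K λ_i r_i²) equals ∏_{n=1}^{K−1} [ Σ_{m=n}^K (λ_m/λ_n) (P_m/P_n)^{2/β} ]^{−1}. (This is Proposition 1 of the paper: the probability that the maximum received powers C_i = P_i r_i^{−β} from K independent tiers satisfy C_1 > C_2 > … > C_K.) -/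
open Real MeasureTheory Finset

/-- The one-variable factor. -/
noncomputable def gfac (a l x : ℝ) : ENNReal :=
  if a < x then ENNReal.ofReal (2 * π * l * x * Real.exp (-π * (l * x ^ 2))) else 0

/-- The full integrand, defined recursively. -/
noncomputable def Ffac : (n : ℕ) → (Fin n → ℝ) → (Fin n → ℝ) → ℝ → (Fin n → ℝ) → ENNReal
  | 0, _, _, _, _ => 1
  | n + 1, l, p, s, r => gfac (p 0 * s) (l 0) (r 0) *
      Ffac n (fun i => l i.succ) (fun i => p i.succ) (r 0 / p 0) (fun i => r i.succ)

lemma measurable_gfac (l : ℝ) : Measurable (fun z : ℝ × ℝ => gfac z.1 l z.2) := by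
  unfold gfac
  refine Measurable.ite (measurableSet_lt measurable_fst measurable_snd) ?_ measurable_const
  fun_prop

lemma measurable_Ffac : ∀ (n : ℕ) (l p : Fin n → ℝ),
    Measurable (fun z : ℝ × (Fin n → ℝ) => Ffac n l p z.1 z.2)
  | 0, _, _ => by simp only [Ffac]; exact measurable_const
  | n + 1, l, p => by
    simp only [Ffac]
    refine Measurable.mul ?_ ?_
    · exact (measurable_gfac (l 0)).comp
        (f := fun z : ℝ × (Fin (n+1) → ℝ) => (p 0 * z.1, z.2 0)) (by fun_prop)
    · exact (measurable_Ffac n _ _).comp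
        (f := fun z : ℝ × (Fin (n+1) → ℝ) => (z.2 0 / p 0, fun i : Fin n => z.2 i.succ))
        (by fun_prop)

lemma Ffac_eq : ∀ (n : ℕ) (l p : Fin n → ℝ) (_ : ∀ i, 0 < l i) (_ : ∀ i, 0 < p i)
    (s : ℝ) (_ : 0 ≤ s) (r : Fin n → ℝ), Ffac n l p s r =
      if (∀ i : Fin n, p i * (Fin.cons s (fun j => r j / p j) : Fin (n+1) → ℝ) i.castSucc < r i)
      then ENNReal.ofReal ((∏ i, 2 * π * l i * r i) * Real.exp (-π * ∑ i, l i * r i ^ 2)) else 0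
  | 0, l, p, hl, hp, s, hs, r => by simp [Ffac]
  | n + 1, l, p, hl, hp, s, hs, r => by
    simp only [Ffac, gfac]
    by_cases h : p 0 * s < r 0
    · have hr : 0 < r 0 := lt_of_le_of_lt (mul_nonneg (hp 0).le hs) h
      rw [Ffac_eq n _ _ (fun i => hl _) (fun i => hp _) _ (div_nonneg hr.le (hp 0).le)]
      have key : (∀ i : Fin (n+1), p i * (Fin.cons s (fun j => r j / p j) : Fin (n+2) → ℝ) i.castSucc < r i)
          ↔ (∀ i : Fin n, p i.succ * (Fin.cons (r 0 / p 0) (fun j : Fin n => r j.succ / p j.succ) : Fin (n+1) → ℝ) i.castSucc < r i.succ) := by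
        rw [Fin.forall_fin_succ]
        have e : (Fin.cons (r 0 / p 0) (fun j : Fin n => r j.succ / p j.succ) : Fin (n+1) → ℝ)
            = fun j => r j / p j := by
          funext j
          refine Fin.cases ?_ (fun j => ?_) j <;> simp
        simp only [e]
        constructor
        · rintro ⟨-, h2⟩ i
          simpa [← Fin.succ_castSucc] using h2 i
        · intro h2
          refine ⟨by simpa using h, fun i => ?_⟩
          simpa [← Fin.succ_castSucc] using h2 i
      rw [if_pos h]
      by_cases h3 : (∀ i : Fin n, p i.succ * (Fin.cons (r 0 / p 0) (fun j : Fin n => r j.succ / p j.succ) : Fin (n+1) → ℝ) i.castSucc < r i.succ)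
      · rw [if_pos h3, if_pos (key.2 h3), ← ENNReal.ofReal_mul]
        · congr 1
          rw [Fin.prod_univ_succ, Fin.sum_univ_succ, mul_add, Real.exp_add]
          ring
        · have := hl 0
          positivity
      · rw [if_neg h3, if_neg (fun h4 => h3 (key.1 h4)), mul_zero]
    · rw [if_neg h, zero_mul, if_neg]
      intro h2
      exact h (by simpa using h2 0)

lemma lint_one (l c a : ℝ) (hl : 0 < l) (hc : 0 < c) (ha : 0 ≤ a) :
    ∫⁻ x in Set.Ioi a, ENNReal.ofReal (2 * π * l * x * Real.exp (-π * (c * x ^ 2))) =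
      ENNReal.ofReal (l / c * Real.exp (-π * (c * a ^ 2))) := by
  have hd : ∀ x ∈ Set.Ici a, HasDerivAt (fun x : ℝ => -(l / c) * Real.exp (-π * (c * x ^ 2)))
      (2 * π * l * x * Real.exp (-π * (c * x ^ 2))) x := by
    intro x _
    have h1 : HasDerivAt (fun x : ℝ => -π * (c * x ^ 2)) (-π * (c * (2 * x))) x := by
      simpa using ((hasDerivAt_pow 2 x).const_mul c).const_mul (-π)
    refine ((h1.exp).const_mul (-(l / c))).congr_deriv ?_
    field_simp
  have hpos : ∀ x ∈ Set.Ioi a, 0 ≤ 2 * π * l * x * Real.exp (-π * (c * x ^ 2)) := by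
    intro x hx
    have : 0 < x := lt_of_le_of_lt ha hx
    positivity
  have hlim : Filter.Tendsto (fun x : ℝ => -(l / c) * Real.exp (-π * (c * x ^ 2)))
      Filter.atTop (nhds 0) := by
    have h1 : Filter.Tendsto (fun x : ℝ => -π * (c * x ^ 2)) Filter.atTop Filter.atBot := by
      have : Filter.Tendsto (fun x : ℝ => (π * c) * x ^ 2) Filter.atTop Filter.atTop :=
        (Filter.tendsto_pow_atTop two_ne_zero).const_mul_atTop (by positivity)
      refine (Filter.tendsto_neg_atTop_atBot.comp this).congr (fun x => ?_)
      simp only [Function.comp]; ring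
    simpa using (Real.tendsto_exp_atBot.comp h1).const_mul (-(l / c))
  rw [← ofReal_integral_eq_lintegral_ofReal
    (integrableOn_Ioi_deriv_of_nonneg' hd hpos hlim)
    ((ae_restrict_iff' measurableSet_Ioi).2 (Filter.Eventually.of_forall hpos)),
    integral_Ioi_of_hasDerivAt_of_nonneg' hd hpos hlim]
  congr 1
  ring

/-- Tail sum. -/
noncomputable def Tsum {n : ℕ} (l p : Fin n → ℝ) (i : Fin n) : ℝ :=
  ∑ m ∈ Finset.univ.filter (fun m : Fin n => (i : ℕ) ≤ (m : ℕ)), l m * p m ^ 2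

lemma Tsum_zero {n : ℕ} (l p : Fin (n+1) → ℝ) : Tsum l p 0 = ∑ i, l i * p i ^ 2 := by
  simp [Tsum]

lemma Tsum_succ {n : ℕ} (l p : Fin (n+1) → ℝ) (i : Fin n) :
    Tsum l p i.succ = Tsum (fun i => l i.succ) (fun i => p i.succ) i := by
  simp [Tsum, Finset.sum_filter, Fin.sum_univ_succ]

lemma lint_F : ∀ (n : ℕ) (l p : Fin n → ℝ) (_ : ∀ i, 0 < l i) (_ : ∀ i, 0 < p i)
    (s : ℝ) (_ : 0 ≤ s), ∫⁻ r, Ffac n l p s r =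
      ENNReal.ofReal ((∏ i, l i * p i ^ 2 / Tsum l p i) *
        Real.exp (-π * ((∑ i, l i * p i ^ 2) * s ^ 2)))
  | 0, l, p, hl, hp, s, hs => by simp [Ffac, volume_pi]
  | n + 1, l, p, hl, hp, s, hs => by
    have hmp := (volume_preserving_piFinSuccAbove (fun _ : Fin (n+1) => ℝ) 0).symm
    have hm0 : Measurable (fun r => Ffac (n+1) l p s r) :=
      (measurable_Ffac (n+1) l p).comp measurable_prodMk_left
    rw [← hmp.lintegral_comp hm0]
    have e : ∀ z : ℝ × (Fin n → ℝ), Ffac (n+1) l p s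
        ((MeasurableEquiv.piFinSuccAbove (fun _ : Fin (n+1) => ℝ) 0).symm z) =
        gfac (p 0 * s) (l 0) z.1 *
          Ffac n (fun i => l i.succ) (fun i => p i.succ) (z.1 / p 0) z.2 := by
      intro z
      simp [Ffac, MeasurableEquiv.piFinSuccAbove_symm_apply]
    simp only [e]
    have hm2 : Measurable (fun z : ℝ × (Fin n → ℝ) =>
        Ffac n (fun i => l i.succ) (fun i => p i.succ) (z.1 / p 0) z.2) :=
      (measurable_Ffac n _ _).comp (f := fun z : ℝ × (Fin n → ℝ) => (z.1 / p 0, z.2))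
        (by fun_prop)
    have hm1 : Measurable (fun z : ℝ × (Fin n → ℝ) => gfac (p 0 * s) (l 0) z.1) :=
      (measurable_gfac (l 0)).comp (f := fun z : ℝ × (Fin n → ℝ) => (p 0 * s, z.1))
        (by fun_prop)
    have hm3 : Measurable (fun z : ℝ × (Fin n → ℝ) => gfac (p 0 * s) (l 0) z.1 *
        Ffac n (fun i => l i.succ) (fun i => p i.succ) (z.1 / p 0) z.2) := hm1.mul hm2
    rw [Measure.volume_eq_prod, lintegral_prod _ hm3.aemeasurable]
    set C := ∏ i : Fin n, l i.succ * p i.succ ^ 2 /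
      Tsum (fun i => l i.succ) (fun i => p i.succ) i with hC
    set S := ∑ i : Fin n, l i.succ * p i.succ ^ 2 with hS
    have hS0 : 0 ≤ S := Finset.sum_nonneg fun i _ => by have := hl i.succ; positivity
    have hC0 : 0 ≤ C := Finset.prod_nonneg fun i _ => by
      have := hl i.succ
      refine div_nonneg (by positivity) (Finset.sum_nonneg fun j _ => ?_)
      have := hl j.succ
      positivity
    have hl0 := hl 0
    have hp0 := hp 0
    have e2 : ∀ x : ℝ, (∫⁻ y, gfac (p 0 * s) (l 0) x *
          Ffac n (fun i => l i.succ) (fun i => p i.succ) (x / p 0) y) =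
        (Set.Ioi (p 0 * s)).indicator (fun x => ENNReal.ofReal C * ENNReal.ofReal
          (2 * π * l 0 * x * Real.exp (-π * ((l 0 + S / p 0 ^ 2) * x ^ 2)))) x := by
      intro x
      have hm4 : Measurable (fun y =>
          Ffac n (fun i => l i.succ) (fun i => p i.succ) (x / p 0) y) :=
        (measurable_Ffac n _ _).comp measurable_prodMk_left
      rw [lintegral_const_mul _ hm4]
      by_cases hx : p 0 * s < x
      · have hx0 : 0 < x := lt_of_le_of_lt (by positivity) hx
        rw [lint_F n _ _ (fun i => hl _) (fun i => hp _) _ (by positivity),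
          Set.indicator_of_mem (by exact hx), gfac, if_pos hx, ← ENNReal.ofReal_mul hC0,
          ← ENNReal.ofReal_mul (by positivity), ← hC, ← hS]
        congr 1
        rw [show -π * ((l 0 + S / p 0 ^ 2) * x ^ 2) = -π * (l 0 * x ^ 2) +
          -π * (S * (x / p 0) ^ 2) by field_simp; ring, Real.exp_add]
        ring
      · rw [Set.indicator_of_notMem (by exact hx), gfac, if_neg hx, zero_mul]
    simp only [e2]
    rw [lintegral_indicator measurableSet_Ioi, lintegral_const_mul _ (by fun_prop),
      lint_one _ _ _ hl0 (by positivity) (by positivity), ← ENNReal.ofReal_mul hC0]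
    congr 1
    rw [Fin.prod_univ_succ, Tsum_zero, Fin.sum_univ_succ, ← hS]
    simp only [Tsum_succ]
    rw [← hC]
    have e3 : (l 0 + S / p 0 ^ 2) * (p 0 * s) ^ 2 = (l 0 * p 0 ^ 2 + S) * s ^ 2 := by
      field_simp
    have e4 : l 0 / (l 0 + S / p 0 ^ 2) = l 0 * p 0 ^ 2 / (l 0 * p 0 ^ 2 + S) := by
      field_simp
    rw [e3, e4]
    ring

/-- Proposition 1: the probability that the maximum received powers
`C_i = P_i r_i^{-β}` from `K` independent tiers satisfy `C_1 > C_2 > … > C_K`,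
computed as the integral of the joint nearest-distance density over the ordering region. -/
theorem prop1_ordering_probability (K : ℕ) (hK : 2 ≤ K) (β : ℝ) (hβ : 0 < β)
    (lam P : Fin K → ℝ) (hlam : ∀ i, 0 < lam i) (hP : ∀ i, 0 < P i) :
    (∫ r in {r : Fin K → ℝ | 0 < r ⟨0, by omega⟩ ∧
        ∀ i j : Fin K, (j : ℕ) = (i : ℕ) + 1 → (P j / P i) ^ (1 / β) * r i < r j},
      (∏ i, 2 * π * lam i * r i) * Real.exp (-π * ∑ i, lam i * r i ^ 2)) =
    ∏ n ∈ Finset.univ.filter (fun n : Fin K => (n : ℕ) + 1 < K),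
      (∑ m ∈ Finset.univ.filter (fun m : Fin K => (n : ℕ) ≤ (m : ℕ)),
        lam m / lam n * (P m / P n) ^ (2 / β))⁻¹ := by
  obtain ⟨n, rfl⟩ : ∃ n, K = n + 1 := ⟨K - 1, by omega⟩
  set p : Fin (n+1) → ℝ := fun i => P i ^ (1 / β) with hp
  have hp0 : ∀ i, 0 < p i := fun i => Real.rpow_pos_of_pos (hP i) _
  have hdiv : ∀ i j, (P j / P i) ^ (1 / β) = p j / p i := fun i j =>
    Real.div_rpow (hP j).le (hP i).le _
  have hdiv2 : ∀ i j, (P j / P i) ^ (2 / β) = (p j / p i) ^ 2 := fun i j => by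
    rw [← hdiv, ← Real.rpow_natCast, ← Real.rpow_mul (div_pos (hP j) (hP i)).le]
    congr 1
    push_cast
    ring
  simp only [hdiv, hdiv2]
  set Ω : Set (Fin (n+1) → ℝ) := {r | 0 < r ⟨0, by omega⟩ ∧
        ∀ i j : Fin (n+1), (j : ℕ) = (i : ℕ) + 1 → p j / p i * r i < r j} with hΩ
  have hmem : ∀ r, r ∈ Ω ↔ ∀ i : Fin (n+1),
      p i * (Fin.cons 0 (fun j => r j / p j) : Fin (n+2) → ℝ) i.castSucc < r i := by
    intro r
    rw [Fin.forall_fin_succ]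
    constructor
    · rintro ⟨h0, h1⟩
      refine ⟨by simpa using h0, fun i => ?_⟩
      have := h1 i.castSucc i.succ (by simp)
      rw [← Fin.succ_castSucc, Fin.cons_succ]
      calc _ = p i.succ / p i.castSucc * r i.castSucc := by ring
        _ < _ := this
    · rintro ⟨h0, h1⟩
      refine ⟨by simpa using h0, fun i j hij => ?_⟩
      have hi : (i : ℕ) < n := by have := j.2; omega
      obtain ⟨k, rfl⟩ : ∃ k : Fin n, i = k.castSucc := ⟨⟨i, hi⟩, rfl⟩
      obtain rfl : j = k.succ := Fin.ext (by simpa using hij)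
      have := h1 k
      rw [← Fin.succ_castSucc, Fin.cons_succ] at this
      calc _ = p k.succ * (r k.castSucc / p k.castSucc) := by ring
        _ < _ := this
  have hΩm : MeasurableSet Ω := by
    have : Ω = ⋂ i : Fin (n+1), {r |
      p i * (Fin.cons 0 (fun j => r j / p j) : Fin (n+2) → ℝ) i.castSucc < r i} := by
      ext r; rw [hmem]; simp
    rw [this]
    refine MeasurableSet.iInter fun i => measurableSet_lt ?_ (by fun_prop)
    refine Measurable.const_mul ?_ _
    refine Fin.cases ?_ (fun j => ?_) i
    · simp
    · simp only [← Fin.succ_castSucc, Fin.cons_succ]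
      fun_prop
  have hpos : ∀ r ∈ Ω, ∀ i, 0 < r i := by
    intro r hr i
    refine Fin.induction ?_ (fun i ih => ?_) i
    · exact hr.1
    · have := hr.2 i.castSucc i.succ (by simp)
      have h1 := hp0 i.castSucc
      have h2 := hp0 i.succ
      exact lt_trans (by positivity) this
  have hTpos : ∀ i, 0 < Tsum lam p i := fun i =>
    Finset.sum_pos (fun j _ => by have := hlam j; have := hp0 j; positivity) ⟨i, by simp⟩
  rw [integral_eq_lintegral_of_nonneg_ae, ← lintegral_indicator hΩm]
  · have : ∀ r, Ω.indicator (fun r => ENNReal.ofReal ((∏ i, 2 * π * lam i * r i) *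
        Real.exp (-π * ∑ i, lam i * r i ^ 2))) r = Ffac (n+1) lam p 0 r := by
      intro r
      rw [Ffac_eq _ _ _ hlam hp0 _ le_rfl, Set.indicator_apply]
      simp only [hmem]
    simp only [this]
    rw [lint_F _ _ _ hlam hp0 _ le_rfl, ENNReal.toReal_ofReal]
    · rw [Finset.prod_filter]
      simp only [ne_eq, OfNat.ofNat_ne_zero, not_false_eq_true, zero_pow, mul_zero, Real.exp_zero,
        mul_one]
      refine Finset.prod_congr rfl fun i _ => ?_
      have hl := hlam i
      have hpi := hp0 i
      have e : ∑ m ∈ Finset.univ.filter (fun m : Fin (n+1) => (i : ℕ) ≤ (m : ℕ)),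
          lam m / lam i * (p m / p i) ^ 2 = Tsum lam p i / (lam i * p i ^ 2) := by
        rw [Tsum, Finset.sum_div]
        refine Finset.sum_congr rfl fun m _ => ?_
        field_simp
      split_ifs with h
      · rw [e, inv_div]
      · have : Tsum lam p i = lam i * p i ^ 2 := by
          rw [Tsum, Finset.sum_eq_single_of_mem i (by simp)]
          intro b hb hbi
          exfalso
          apply hbi
          simp only [Finset.mem_filter] at hb
          apply Fin.ext
          have := b.2
          omega
        rw [this, div_self (by positivity)]
    · refine mul_nonneg (Finset.prod_nonneg fun i _ => ?_) (Real.exp_pos _).le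
      have := hlam i
      have := hTpos i
      positivity
  · refine (ae_restrict_iff' hΩm).2 (Filter.Eventually.of_forall fun r hr => ?_)
    refine mul_nonneg (Finset.prod_nonneg fun i _ => ?_) (Real.exp_pos _).le
    have := hlam i
    have := hpos r hr i
    positivity
  · refine Measurable.aestronglyMeasurable ?_
    fun_prop
end

section
/- Let K ≥ 2 be an integer, let β > 0, let λ_1,…,λ_K > 0 and P_1,…,P_K > 0, and fix an index i ∈ {1,…,K}. Let Ω_i ⊆ ℝ^K be the region Ω_i = { (r_1,…,r_K) : 0 < r_i and r_m > (P_m/P_i)^{1/β} · r_i for all m ≠ i }. Then the iterated integral over Ω_i of the function (r_1,…,r_K) ↦ (∏_{m=1}^K 2π λ_m r_m) · exp(−π Σ_{m=1}^K λ_m r_m²) equals [ Σ_{m=1}^K (λ_m/λ_i) (P_m/P_i)^{2/β} ]^{−1}. (This is Lemma 1 of the paper: the probability G_{K,i} that the tier-i received power exceeds that of every other tier.) -/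
open Real MeasureTheory Finset

lemma aux_integrable (l : ℝ) (hl : 0 < l) :
    Integrable (fun r : ℝ => 2 * π * l * r * Real.exp (-π * (l * r ^ 2))) := by
  have h := (integrable_mul_exp_neg_mul_sq (b := π * l) (by positivity)).const_mul (2 * π * l)
  refine h.congr (Filter.Eventually.of_forall fun r => ?_)
  simp only
  rw [show -π * (l * r ^ 2) = -(π * l) * r ^ 2 by ring]
  ring

lemma aux_tail (l : ℝ) (hl : 0 < l) (a : ℝ) :
    ∫ r in Set.Ioi a, 2 * π * l * r * Real.exp (-π * (l * r ^ 2))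
      = Real.exp (-π * (l * a ^ 2)) := by
  have hd : ∀ x ∈ Set.Ici a, HasDerivAt (fun r : ℝ => -Real.exp (-π * (l * r ^ 2)))
      (2 * π * l * x * Real.exp (-π * (l * x ^ 2))) x := by
    intro x _
    have h := ((((hasDerivAt_pow 2 x).const_mul l).const_mul (-π)).exp).neg
    refine HasDerivAt.congr_deriv h ?_
    norm_num
    ring
  have ht : Filter.Tendsto (fun r : ℝ => -Real.exp (-π * (l * r ^ 2))) Filter.atTop
      (nhds 0) := by
    rw [← neg_zero]
    refine (Real.tendsto_exp_atBot.comp ?_).neg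
    refine Filter.Tendsto.const_mul_atTop_of_neg (neg_lt_zero.mpr pi_pos) ?_
    exact Filter.Tendsto.const_mul_atTop hl (Filter.tendsto_pow_atTop two_ne_zero)
  have := integral_Ioi_of_hasDerivAt_of_tendsto' hd (aux_integrable l hl).integrableOn ht
  rw [this]; ring

lemma aux_main (n : ℕ) (lam c : Fin (n + 1) → ℝ) (hlam : ∀ m, 0 < lam m)
    (i : Fin (n + 1)) (hci : c i = 1) :
    (∫ r in {r : Fin (n + 1) → ℝ | 0 < r i ∧ ∀ m, m ≠ i → c m * r i < r m},
      ∏ m, (2 * π * lam m * r m * Real.exp (-π * (lam m * r m ^ 2)))) =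
    lam i / ∑ m, lam m * c m ^ 2 := by
  have hS : 0 < ∑ m, lam m * c m ^ 2 := by
    refine Finset.sum_pos' (fun m _ => mul_nonneg (hlam m).le (sq_nonneg _)) ⟨i, mem_univ _, ?_⟩
    rw [hci]; simpa using hlam i
  set g : Fin (n + 1) → ℝ → ℝ := fun m r => 2 * π * lam m * r * Real.exp (-π * (lam m * r ^ 2))
    with hg
  set A := {r : Fin (n + 1) → ℝ | 0 < r i ∧ ∀ m, m ≠ i → c m * r i < r m} with hA
  have hAm : MeasurableSet A := by
    rw [hA]; measurability
  have hint : Integrable (fun r : Fin (n + 1) → ℝ => ∏ m, g m (r m)) :=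
    Integrable.fintype_prod (fun m => aux_integrable (lam m) (hlam m))
  have hintA := hint.indicator hAm
  have hmp := (volume_preserving_piFinSuccAbove (fun _ : Fin (n + 1) => ℝ) i).symm
  change (∫ r in A, ∏ m, g m (r m)) = _
  rw [← integral_indicator hAm, ← hmp.integral_comp', Measure.volume_eq_prod, integral_prod]
  swap
  · exact (hmp.integrable_comp_emb (MeasurableEquiv.measurableEmbedding _)).2 hintA
  have key : ∀ x : ℝ, (∫ y : Fin n → ℝ, A.indicator (fun r => ∏ m, g m (r m))
      ((MeasurableEquiv.piFinSuccAbove (fun _ : Fin (n + 1) => ℝ) i).symm (x, y)))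
      = (Set.Ioi (0 : ℝ)).indicator (fun x => lam i / (∑ m, lam m * c m ^ 2) *
        (2 * π * (∑ m, lam m * c m ^ 2) * x *
          Real.exp (-π * ((∑ m, lam m * c m ^ 2) * x ^ 2)))) x := by
    intro x
    by_cases hx : 0 < x
    · rw [Set.indicator_of_mem (Set.mem_Ioi.2 hx)]
      have h1 : ∀ y : Fin n → ℝ, A.indicator (fun r => ∏ m, g m (r m))
          ((MeasurableEquiv.piFinSuccAbove (fun _ : Fin (n + 1) => ℝ) i).symm (x, y))
          = g i x * ∏ j, (Set.Ioi (c (i.succAbove j) * x)).indicator (g (i.succAbove j)) (y j) := by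
        intro y
        change A.indicator (fun r => ∏ m, g m (r m)) (i.insertNth x y) = _
        by_cases hy : ∀ j, c (i.succAbove j) * x < y j
        · rw [Set.indicator_of_mem, Fin.prod_univ_succAbove _ i]
          · simp only [Fin.insertNth_apply_same, Fin.insertNth_apply_succAbove]
            congr 1
            refine Finset.prod_congr rfl fun j _ => ?_
            rw [Set.indicator_of_mem (Set.mem_Ioi.2 (hy j))]
          · refine ⟨by simpa using hx, fun m hm => ?_⟩
            obtain ⟨j, rfl⟩ := Fin.exists_succAbove_eq hm
            simpa using hy j
        · rw [Set.indicator_of_notMem]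
          · push Not at hy
            obtain ⟨j, hj⟩ := hy
            rw [Finset.prod_eq_zero (mem_univ j), mul_zero]
            exact Set.indicator_of_notMem (by simpa using hj) _
          · rintro ⟨_, h⟩
            refine hy fun j => ?_
            simpa using h (i.succAbove j) (Fin.succAbove_ne i j)
      simp_rw [h1]
      rw [integral_const_mul, integral_fintype_prod_volume_eq_prod]
      simp_rw [integral_indicator measurableSet_Ioi]
      have h2 : ∀ j, ∫ r in Set.Ioi (c (i.succAbove j) * x), g (i.succAbove j) r
          = Real.exp (-π * (lam (i.succAbove j) * (c (i.succAbove j) * x) ^ 2)) :=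
        fun j => aux_tail _ (hlam _) _
      simp_rw [h2]
      rw [← Real.exp_sum]
      simp only [hg]
      rw [mul_assoc, ← Real.exp_add]
      have h3 : -π * (lam i * x ^ 2) + ∑ j, -π * (lam (i.succAbove j) *
          (c (i.succAbove j) * x) ^ 2) = -π * ((∑ m, lam m * c m ^ 2) * x ^ 2) := by
        rw [Fin.sum_univ_succAbove _ i, hci, ← Finset.mul_sum, add_mul, mul_add, Finset.sum_mul]
        simp only [mul_pow, mul_assoc, one_pow, one_mul]
      rw [h3]
      field_simp
    · rw [Set.indicator_of_notMem (by simpa using hx)]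
      rw [← integral_zero (Fin n → ℝ) ℝ]
      congr 1
      funext y
      change A.indicator (fun r => ∏ m, g m (r m)) (i.insertNth x y) = _
      rw [Set.indicator_of_notMem]
      rintro ⟨h, _⟩
      exact hx (by simpa using h)
  simp_rw [key]
  rw [integral_indicator measurableSet_Ioi, integral_const_mul, aux_tail _ hS]
  simp

/-- Lemma 1: the probability `G_{K,i}` that the tier-`i` received power exceeds
that of every other tier, computed as the integral of the joint nearest-distance
density over the region where tier `i` dominates. -/
theorem lemma1_association_probability (K : ℕ) (hK : 2 ≤ K) (β : ℝ) (hβ : 0 < β)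
    (lam P : Fin K → ℝ) (hlam : ∀ m, 0 < lam m) (hP : ∀ m, 0 < P m) (i : Fin K) :
    (∫ r in {r : Fin K → ℝ | 0 < r i ∧
        ∀ m : Fin K, m ≠ i → (P m / P i) ^ (1 / β) * r i < r m},
      (∏ m, 2 * π * lam m * r m) * Real.exp (-π * ∑ m, lam m * r m ^ 2)) =
    (∑ m, lam m / lam i * (P m / P i) ^ (2 / β))⁻¹ := by
  obtain ⟨n, rfl⟩ : ∃ n, K = n + 1 := ⟨K - 1, by omega⟩
  have h := aux_main n lam (fun m => (P m / P i) ^ (1 / β)) hlam i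
    (by simp [div_self (hP i).ne'])
  simp_rw [Finset.prod_mul_distrib (f := fun m => 2 * π * lam m * _), ← Real.exp_sum,
    ← Finset.mul_sum] at h
  rw [h]
  have h2 : ∀ m, ((P m / P i) ^ (1 / β)) ^ 2 = (P m / P i) ^ (2 / β) := by
    intro m
    rw [← Real.rpow_natCast, ← Real.rpow_mul (div_pos (hP m) (hP i)).le]
    congr 1
    push_cast
    ring
  simp_rw [h2]
  rw [← inv_div, Finset.sum_div]
  congr 1
  refine Finset.sum_congr rfl fun m _ => ?_
  ring
end

section
/- Let M and N be integers with 1 ≤ M < N. Then the function γ ↦ ( Σ_{i=1}^M i^{−γ} ) / ( Σ_{i=1}^N i^{−γ} ) is strictly increasing on [0, ∞). -/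
open Finset

/-- The Zipf cached-content mass `F(1,M) = (Σ_{i=1}^M i^{−γ}) / (Σ_{i=1}^N i^{−γ})`
is strictly increasing in the skew parameter `γ ≥ 0` when `1 ≤ M < N`. -/
theorem zipf_mass_strict_mono (M N : ℕ) (hM : 1 ≤ M) (hMN : M < N) :
    StrictMonoOn (fun γ : ℝ =>
      (∑ i ∈ Finset.Icc 1 M, (i : ℝ) ^ (-γ)) / (∑ i ∈ Finset.Icc 1 N, (i : ℝ) ^ (-γ)))
      (Set.Ici 0) := by
  intro a _ b _ hab
  have hsplit : ∀ γ : ℝ, ∑ i ∈ Finset.Icc 1 N, (i : ℝ) ^ (-γ) =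
      ∑ i ∈ Finset.Icc 1 M, (i : ℝ) ^ (-γ) + ∑ i ∈ Finset.Ioc M N, (i : ℝ) ^ (-γ) := by
    intro γ
    rw [← Finset.sum_union]
    · congr 1
      ext x
      simp only [Finset.mem_union, Finset.mem_Icc, Finset.mem_Ioc]
      omega
    · rw [Finset.disjoint_left]
      intro x
      simp only [Finset.mem_Icc, Finset.mem_Ioc]
      omega
  have hpos : ∀ γ : ℝ, 0 < ∑ i ∈ Finset.Icc 1 N, (i : ℝ) ^ (-γ) := by
    intro γ
    apply Finset.sum_pos
    · intro i hi
      have : 0 < i := (Finset.mem_Icc.mp hi).1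
      positivity
    · exact ⟨1, Finset.mem_Icc.mpr (by omega)⟩
  have key : (∑ i ∈ Finset.Icc 1 M, (i : ℝ) ^ (-a)) * (∑ j ∈ Finset.Ioc M N, (j : ℝ) ^ (-b)) <
      (∑ i ∈ Finset.Icc 1 M, (i : ℝ) ^ (-b)) * (∑ j ∈ Finset.Ioc M N, (j : ℝ) ^ (-a)) := by
    rw [Finset.sum_mul_sum, Finset.sum_mul_sum]
    refine Finset.sum_lt_sum_of_nonempty ⟨1, Finset.mem_Icc.mpr (by omega)⟩ ?_
    intro i hi
    refine Finset.sum_lt_sum_of_nonempty ⟨N, Finset.mem_Ioc.mpr (by omega)⟩ ?_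
    intro j hj
    rw [Finset.mem_Icc] at hi
    rw [Finset.mem_Ioc] at hj
    have hi0 : (0 : ℝ) < i := by exact_mod_cast hi.1
    have hij : (i : ℝ) < j := by exact_mod_cast (by omega : i < j)
    have hj0 : (0 : ℝ) < j := hi0.trans hij
    have h := Real.rpow_lt_rpow hi0.le hij (sub_pos.mpr hab)
    have e1 : (i : ℝ) ^ (-a) = (i : ℝ) ^ (-b) * (i : ℝ) ^ (b - a) := by
      rw [← Real.rpow_add hi0]; congr 1; ring
    have e2 : (j : ℝ) ^ (-a) = (j : ℝ) ^ (-b) * (j : ℝ) ^ (b - a) := by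
      rw [← Real.rpow_add hj0]; congr 1; ring
    have hp : 0 < (i : ℝ) ^ (-b) * (j : ℝ) ^ (-b) := by positivity
    rw [e1, e2]
    have := mul_lt_mul_of_pos_left h hp
    linarith
  show _ / _ < _ / _
  rw [div_lt_div_iff₀ (hpos a) (hpos b), hsplit a, hsplit b]
  linarith
end

section
/- Let D be a nonempty finite index set, let ρ_i ≥ 0 for i ∈ D with ρ = Σ_{i∈D} ρ_i < 1, and define π(x) = (1 − ρ) · ( (Σ_j x_j)! / ∏_j x_j! ) · ∏_j ρ_j^{x_j} for x ∈ ℕ^D. Then for every i ∈ D, Σ_{x ∈ ℕ^D} π(x) · x_i = ρ_i / (1 − ρ). -/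
open Finset

lemma level_sum (D : Type*) [Fintype D] [DecidableEq D] (ρ : D → ℝ) (i : D) (n : ℕ) :
    ∑ x ∈ piAntidiag (univ : Finset D) n,
      ((Nat.multinomial Finset.univ x : ℝ) * ∏ j, ρ j ^ x j) * (x i : ℝ)
      = n * (∑ j, ρ j) ^ (n - 1) * ρ i := by
  have key : ∀ t : ℝ, (∑ j, ρ j + (t - 1) * ρ i) ^ n =
      ∑ x ∈ piAntidiag (univ : Finset D) n,
        ((Nat.multinomial Finset.univ x : ℝ) * ∏ j, ρ j ^ x j) * t ^ x i := by
    intro t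
    have h := Finset.sum_pow_eq_sum_piAntidiag (univ : Finset D)
      (fun j => ρ j * (if j = i then t else 1)) n
    have h1 : ∑ j, ρ j * (if j = i then t else 1) = ∑ j, ρ j + (t - 1) * ρ i := by
      have : ∀ j, ρ j * (if j = i then t else 1) = ρ j + (if j = i then (t - 1) * ρ j else 0) := by
        intro j
        split_ifs <;> ring
      simp only [this, Finset.sum_add_distrib]
      simp
    rw [h1] at h
    rw [h]
    refine Finset.sum_congr rfl fun x _ => ?_
    simp only [mul_pow, Finset.prod_mul_distrib, ite_pow, one_pow]
    simp [mul_assoc]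
  have hL : HasDerivAt (fun t : ℝ => (∑ j, ρ j + (t - 1) * ρ i) ^ n)
      (n * (∑ j, ρ j) ^ (n - 1) * ρ i) 1 := by
    have := (((((hasDerivAt_id (1 : ℝ)).sub_const 1).mul_const (ρ i)).const_add (∑ j, ρ j)).pow n)
    have e : (n : ℝ) * (∑ j, ρ j + (id (1 : ℝ) - 1) * ρ i) ^ (n - 1) * (1 * ρ i) =
        n * (∑ j, ρ j) ^ (n - 1) * ρ i := by simp
    rw [← e]
    exact this
  have hR : HasDerivAt (fun t : ℝ => ∑ x ∈ piAntidiag (univ : Finset D) n,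
        ((Nat.multinomial Finset.univ x : ℝ) * ∏ j, ρ j ^ x j) * t ^ x i)
      (∑ x ∈ piAntidiag (univ : Finset D) n,
        ((Nat.multinomial Finset.univ x : ℝ) * ∏ j, ρ j ^ x j) * (x i : ℝ)) 1 := by
    refine HasDerivAt.fun_sum fun x _ => ?_
    have := (hasDerivAt_pow (x i) (1 : ℝ)).const_mul
      ((Nat.multinomial Finset.univ x : ℝ) * ∏ j, ρ j ^ x j)
    simpa using this
  rw [← funext key] at hR
  exact hR.unique hL

/-- Vectors of naturals, graded by their total. -/
def levelEquiv (D : Type*) [Fintype D] [DecidableEq D] :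
    (Σ n : ℕ, {x // x ∈ piAntidiag (univ : Finset D) n}) ≃ (D → ℕ) where
  toFun p := p.2.1
  invFun x := ⟨∑ j, x j, x, by simp⟩
  left_inv := by
    rintro ⟨n, x, hx⟩
    have : ∑ j, x j = n := by simpa using hx
    subst this
    rfl
  right_inv _ := rfl

lemma hasSum_level (r : ℝ) (h0 : 0 ≤ r) (h1 : r < 1) :
    HasSum (fun n : ℕ => (n : ℝ) * r ^ (n - 1)) (1 / (1 - r) ^ 2) := by
  have hr : ‖r‖ < 1 := by rwa [Real.norm_of_nonneg h0]
  have h := (hasSum_coe_mul_geometric_of_norm_lt_one hr).add (hasSum_geometric_of_norm_lt_one hr)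
  rw [← hasSum_nat_add_iff' 1]
  have e1 : (fun n : ℕ => ((n + 1 : ℕ) : ℝ) * r ^ (n + 1 - 1)) =
      fun n : ℕ => (n : ℝ) * r ^ n + r ^ n := by
    funext n
    simp
    ring
  have e2 : 1 / (1 - r) ^ 2 - ∑ i ∈ range 1, (i : ℝ) * r ^ (i - 1) =
      r / (1 - r) ^ 2 + (1 - r)⁻¹ := by
    have : 1 - r ≠ 0 := by linarith
    simp
    field_simp
    ring
  rw [e1, e2]
  exact h

/-- Stationary mean number of class-`i` requests in the multiclass
processor-sharing queue: `Σ_x π(x) x_i = ρ_i/(1−ρ)`, where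
`π(x) = (1−ρ)·multinomial(x)·Π_j ρ_j^{x_j}` and `ρ = Σ ρ_j < 1`. -/
theorem stationary_mean_queue_length (D : Type*) [Fintype D] [Nonempty D]
    (ρ : D → ℝ) (hρ : ∀ i, 0 ≤ ρ i) (hsum : ∑ i, ρ i < 1) :
    ∀ i : D,
      (∑' x : D → ℕ,
        ((1 - ∑ j, ρ j) * (Nat.multinomial Finset.univ x : ℝ) * ∏ j, ρ j ^ x j) *
          (x i : ℝ)) = ρ i / (1 - ∑ j, ρ j) := by
  classical
  intro i
  have h0 : 0 ≤ ∑ j, ρ j := Finset.sum_nonneg fun j _ => hρ j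
  have hg := (hasSum_level _ h0 hsum).mul_right (ρ i)
  let f : (D → ℕ) → ℝ := fun x =>
    ((Nat.multinomial Finset.univ x : ℝ) * ∏ j, ρ j ^ x j) * (x i : ℝ)
  have hf0 : ∀ x, 0 ≤ f x := fun x =>
    mul_nonneg (mul_nonneg (Nat.cast_nonneg _)
      (Finset.prod_nonneg fun j _ => pow_nonneg (hρ j) _)) (Nat.cast_nonneg _)
  have hfib : ∀ n : ℕ, HasSum (fun c : {x // x ∈ piAntidiag (univ : Finset D) n} =>
      (f ∘ levelEquiv D) ⟨n, c⟩) (n * (∑ j, ρ j) ^ (n - 1) * ρ i) := by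
    intro n
    rw [← level_sum D ρ i n]
    exact Finset.hasSum (piAntidiag (univ : Finset D) n) f
  have hs : Summable (f ∘ levelEquiv D) := by
    refine (summable_sigma_of_nonneg (f := f ∘ levelEquiv D) fun p => hf0 _).2 ⟨fun n => (hfib n).summable, ?_⟩
    simp only [fun n => (hfib n).tsum_eq]
    exact hg.summable
  have hf : HasSum f (1 / (1 - ∑ j, ρ j) ^ 2 * ρ i) :=
    (levelEquiv D).hasSum_iff.1 (HasSum.sigma_of_hasSum hg hfib hs)
  have hne : 1 - ∑ j, ρ j ≠ 0 := by linarith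
  have hfin := (hf.mul_left (1 - ∑ j, ρ j)).tsum_eq
  calc _ = ∑' x, (1 - ∑ j, ρ j) * f x := by
        refine tsum_congr fun x => ?_
        simp only [f]
        ring
    _ = _ := by
        rw [hfin]
        field_simp
end
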